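/- Let n ≥ 5 be odd. Then the flip graph G_{n,2}^C of 2-element subsets of [n] contains two rainbow Hamilton cycles that are edge-disjoint, i.e., no edge of G_{n,2}^C is used by both cycles. -/

import Mathlib

/-! Rainbow cycles in the flip graph of `k`-element subsets of `{1, …, n}`
(represented by `k`-element Finsets of `Fin n`), where two subsets `A`, `B`
are adjacent if `|A △ B| = 2`, and the corresponding edge is labeled by the
2-element set `A △ B`. -/

/-- A rainbow cycle of length `L` in the flip graph `G_{n,k}^C` of `k`-element
subsets of `{1, …, n}`, encoded as an `L`-periodic sequence `V` of `k`-element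
subsets: consecutive subsets differ in exchanging one element for another
(their symmetric difference, the label of the edge, has exactly two elements),
no subset is visited twice within a period, and every one of the `C(n,2)`
possible labels `{x, y}` appears exactly once per period. -/
def IsRainbowCycleC (n k L : ℕ) (V : ℕ → Finset (Fin n)) : Prop :=
  0 < L ∧
  (∀ i, V (i + L) = V i) ∧
  (∀ i < L, ∀ j < L, V i = V j → i = j) ∧
  (∀ i, (V i).card = k) ∧
  (∀ i, (symmDiff (V i) (V (i + 1))).card = 2) ∧
  (∀ x y : Fin n, x ≠ y →
    ((Finset.range L).filter
      (fun i => symmDiff (V i) (V (i + 1)) = {x, y})).card = 1)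

namespace RainbowSubsets

lemma choose_two_of_odd (ℓ : ℕ) : (2 * ℓ + 1).choose 2 = ℓ * (2 * ℓ + 1) := by
  rw [Nat.choose_two_right, show (2 * ℓ + 1) * (2 * ℓ + 1 - 1) = ℓ * (2 * ℓ + 1) * 2 by
    simp; ring]
  simp

section Enumeration

variable {ℓ : ℕ} {D : ℕ → ℕ} {f : ℕ → ZMod (2 * ℓ + 1)}

/-- The elements `f 0, …, f (ℓ - 1)` of `ℤ/(2ℓ+1)` are, up to sign, residues `D i` no two of which
agree up to sign. -/
structure IsHalfSystem (D : ℕ → ℕ) (f : ℕ → ZMod (2 * ℓ + 1)) : Prop where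
  lt : ∀ i < ℓ, D i < 2 * ℓ + 1
  eq_or_neg : ∀ i < ℓ, f i = D i ∨ f i = -(D i : ZMod (2 * ℓ + 1))
  inj : ∀ i < ℓ, ∀ j < ℓ, D i = D j → i = j
  pos : ∀ i < ℓ, 0 < D i
  add_ne : ∀ i < ℓ, ∀ j < ℓ, D i + D j ≠ 2 * ℓ + 1

lemma natCast_inj_of_lt {n a b : ℕ} (ha : a < n) (hb : b < n) (h : (a : ZMod n) = b) : a = b := by
  rw [ZMod.natCast_eq_natCast_iff', Nat.mod_eq_of_lt ha, Nat.mod_eq_of_lt hb] at h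
  exact h

lemma natCast_ne_neg {n a b : ℕ} (ha : a < n) (hb : b < n) (ha0 : 0 < a) (hab : a + b ≠ n) :
    (a : ZMod n) ≠ -b := by
  intro h
  have h0 : ((a + b : ℕ) : ZMod n) = 0 := by
    push_cast
    rw [h, neg_add_cancel]
  obtain ⟨c, hc⟩ := (ZMod.natCast_eq_zero_iff _ _).1 h0
  have hc0 : c ≠ 0 := by rintro rfl; omega
  have hc1 : c ≠ 1 := by rintro rfl; omega
  have : n * 2 ≤ n * c := Nat.mul_le_mul_left n (by omega)
  omega

namespace IsHalfSystem

lemma eq_of_eq_or_eq_neg (h : IsHalfSystem D f) {i j : ℕ} (hi : i < ℓ) (hj : j < ℓ)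
    (hij : f i = f j ∨ f i = -f j) : i = j := by
  have key : (D i : ZMod (2 * ℓ + 1)) = D j ∨ (D i : ZMod (2 * ℓ + 1)) = -D j := by
    rcases h.eq_or_neg i hi with h1 | h1 <;> rcases h.eq_or_neg j hj with h2 | h2 <;>
      rw [h1, h2] at hij <;> simpa [neg_eq_iff_eq_neg, or_comm] using hij
  rcases key with hk | hk
  · exact h.inj i hi j hj (natCast_inj_of_lt (h.lt i hi) (h.lt j hj) hk)
  · exact absurd hk (natCast_ne_neg (h.lt i hi) (h.lt j hj) (h.pos i hi) (h.add_ne i hi j hj))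

lemma ne_neg (h : IsHalfSystem D f) {i : ℕ} (hi : i < ℓ) : f i ≠ -f i := by
  have key := natCast_ne_neg (h.lt i hi) (h.lt i hi) (h.pos i hi) (h.add_ne i hi i hi)
  rcases h.eq_or_neg i hi with h1 | h1 <;> rw [h1]
  · exact key
  · exact fun e => key (neg_injective e)

lemma ne_zero (h : IsHalfSystem D f) {i : ℕ} (hi : i < ℓ) : f i ≠ 0 :=
  fun h0 => h.ne_neg hi (by rw [h0, neg_zero])

lemma pair_inj (h : IsHalfSystem D f) {i j : ℕ} (hi : i < ℓ) (hj : j < ℓ) {g k : ZMod (2 * ℓ + 1)}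
    (e : ({g, g + f i} : Finset (ZMod (2 * ℓ + 1))) = {k, k + f j}) : i = j ∧ g = k := by
  have e' : s(g, g + f i) = s(k, k + f j) := by
    ext a
    simpa using Finset.ext_iff.1 e a
  rw [Sym2.eq_iff] at e'
  rcases e' with ⟨h1, h2⟩ | ⟨h1, h2⟩
  · exact ⟨h.eq_of_eq_or_eq_neg hi hj (Or.inl (by linear_combination h2 - h1)), h1⟩
  · have e3 : f i = -f j := by linear_combination h2 - h1
    obtain rfl := h.eq_of_eq_or_eq_neg hi hj (Or.inr e3)
    exact absurd e3 (h.ne_neg hi)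

lemma neg_pow_mul (h : IsHalfSystem D f) (e : ℕ) :
    IsHalfSystem D (fun i => (-1) ^ e * f i) := by
  refine ⟨h.lt, fun i hi => ?_, h.inj, h.pos, h.add_ne⟩
  rcases neg_one_pow_eq_or (ZMod (2 * ℓ + 1)) e with he | he <;>
    rcases h.eq_or_neg i hi with h1 | h1 <;> simp [he, h1]

variable {s : ZMod (2 * ℓ + 1)} {c : ℕ → ZMod (2 * ℓ + 1)} {F : ℕ → Finset (ZMod (2 * ℓ + 1))}

lemma injOn (h : IsHalfSystem D f) (hℓ : 0 < ℓ) (hs : IsUnit s)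
    (hF : ∀ t, F t = {s * (t / ℓ : ℕ) + c (t % ℓ), s * (t / ℓ : ℕ) + c (t % ℓ) + f (t % ℓ)}) :
    ∀ t < (2 * ℓ + 1).choose 2, ∀ u < (2 * ℓ + 1).choose 2, F t = F u → t = u := by
  rw [choose_two_of_odd, mul_comm ℓ]
  intro t ht u hu e
  rw [hF, hF] at e
  obtain ⟨h1, h2⟩ := h.pair_inj (Nat.mod_lt _ hℓ) (Nat.mod_lt _ hℓ) e
  rw [h1, add_left_inj, hs.mul_right_inj] at h2
  have h3 := natCast_inj_of_lt ((Nat.div_lt_iff_lt_mul hℓ).2 ht)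
    ((Nat.div_lt_iff_lt_mul hℓ).2 hu) h2
  rw [← Nat.div_add_mod t ℓ, ← Nat.div_add_mod u ℓ, h1, h3]

lemma card_eq_two (h : IsHalfSystem D f) (hℓ : 0 < ℓ)
    (hF : ∀ t, F t = {s * (t / ℓ : ℕ) + c (t % ℓ), s * (t / ℓ : ℕ) + c (t % ℓ) + f (t % ℓ)})
    (t : ℕ) : (F t).card = 2 := by
  rw [hF, Finset.card_pair]
  simpa using h.ne_zero (Nat.mod_lt t hℓ)

lemma surj (h : IsHalfSystem D f) (hℓ : 0 < ℓ) (hs : IsUnit s)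
    (hF : ∀ t, F t = {s * (t / ℓ : ℕ) + c (t % ℓ), s * (t / ℓ : ℕ) + c (t % ℓ) + f (t % ℓ)})
    (A : Finset (ZMod (2 * ℓ + 1))) (hA : A.card = 2) :
    ∃ t < (2 * ℓ + 1).choose 2, F t = A := by
  have him : (Finset.range ((2 * ℓ + 1).choose 2)).image F =
      Finset.powersetCard 2 (Finset.univ : Finset (ZMod (2 * ℓ + 1))) := by
    apply Finset.eq_of_subset_of_card_le
    · intro B hB
      obtain ⟨t, -, rfl⟩ := Finset.mem_image.1 hB
      exact Finset.mem_powersetCard.2 ⟨Finset.subset_univ _, h.card_eq_two hℓ hF t⟩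
    · rw [Finset.card_powersetCard, Finset.card_univ, ZMod.card, Finset.card_image_of_injOn,
        Finset.card_range]
      intro t ht u hu e
      exact h.injOn hℓ hs hF t (by simpa using ht) u (by simpa using hu) e
  have hmem : A ∈ (Finset.range ((2 * ℓ + 1).choose 2)).image F := by
    rw [him]
    exact Finset.mem_powersetCard.2 ⟨Finset.subset_univ _, hA⟩
  simpa using hmem

end IsHalfSystem

end Enumeration

/-- The signed differences of the pairs in a rainbow block. -/
def offset (ℓ i : ℕ) : ZMod (2 * ℓ + 1) :=
  if i < ℓ / 2 then (-1) ^ i * ((i + 1 : ℕ) : ZMod (2 * ℓ + 1))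
  else (-1) ^ (i + 1) * ((i + 1 : ℕ) : ZMod (2 * ℓ + 1))

/-- The signed differences of the edge labels in a rainbow block. -/
def labelOffset (ℓ i : ℕ) : ZMod (2 * ℓ + 1) :=
  if i + 1 < ℓ then offset ℓ (i + 1) - offset ℓ i else -offset ℓ i

/-- The difference between the first element of an edge label in a rainbow block and the common
element of the pairs in that block. -/
def labelStart (ℓ e i : ℕ) : ZMod (2 * ℓ + 1) :=
  if i + 1 < ℓ then (-1) ^ e * offset ℓ i else 0

/-- The translates of the block `{0, offset 0}, …, {0, offset (ℓ - 1)}` by multiples of `ℓ`, one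
after the other, all multiplied by `(-1) ^ e`. -/
def sweep (ℓ e t : ℕ) : Finset (ZMod (2 * ℓ + 1)) :=
  {((-1) ^ e * ℓ * (t / ℓ : ℕ) : ZMod (2 * ℓ + 1)),
    (-1) ^ e * ℓ * (t / ℓ : ℕ) + (-1) ^ e * offset ℓ (t % ℓ)}

lemma two_mul_cast_add_one (ℓ : ℕ) : 2 * (ℓ : ZMod (2 * ℓ + 1)) + 1 = 0 := by
  exact_mod_cast ZMod.natCast_self (2 * ℓ + 1)

lemma isUnit_step (ℓ e : ℕ) : IsUnit ((-1) ^ e * ℓ : ZMod (2 * ℓ + 1)) := by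
  refine ((isUnit_one.neg).pow e).mul (IsUnit.of_mul_eq_one (-2) ?_)
  linear_combination -two_mul_cast_add_one ℓ

lemma offset_eq_or_neg (ℓ i : ℕ) :
    offset ℓ i = (i + 1 : ℕ) ∨ offset ℓ i = -((i + 1 : ℕ) : ZMod (2 * ℓ + 1)) := by
  unfold offset
  split_ifs
  · rcases neg_one_pow_eq_or (ZMod (2 * ℓ + 1)) i with h | h <;> simp [h]
  · rcases neg_one_pow_eq_or (ZMod (2 * ℓ + 1)) (i + 1) with h | h <;> simp [h]

lemma isHalfSystem_offset (ℓ : ℕ) : IsHalfSystem (fun i => i + 1) (offset ℓ) where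
  lt i hi := by omega
  eq_or_neg i _ := offset_eq_or_neg ℓ i
  inj i _ j _ h := by omega
  pos i _ := by omega
  add_ne i hi j hj := by omega

lemma isHalfSystem_labelOffset {ℓ : ℕ} (hℓ : 2 ≤ ℓ) :
    IsHalfSystem
      (fun i => if i + 1 < ℓ then if i + 1 = ℓ / 2 then 1 else 2 * i + 3 else ℓ)
      (labelOffset ℓ) where
  lt i hi := by split_ifs <;> omega
  eq_or_neg i hi := by
    unfold labelOffset
    split_ifs with h1 h2
    · have e1 : i < ℓ / 2 := by omega
      have e2 : ¬ i + 1 < ℓ / 2 := by omega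
      simp only [offset, e1, e2, if_true, if_false]
      rcases neg_one_pow_eq_or (ZMod (2 * ℓ + 1)) i with h | h <;> simp [h, pow_succ]
    · have key : offset ℓ (i + 1) - offset ℓ i = -((-1) ^ i * (2 * i + 3)) ∨
          offset ℓ (i + 1) - offset ℓ i = (-1) ^ i * (2 * i + 3) := by
        by_cases e1 : i < ℓ / 2
        · have e2 : i + 1 < ℓ / 2 := by omega
          simp only [offset, e1, e2, if_true]
          left; push_cast; ring
        · have e2 : ¬ i + 1 < ℓ / 2 := by omega
          simp only [offset, e1, e2, if_false]
          right; push_cast; ring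
      push_cast
      rcases neg_one_pow_eq_or (ZMod (2 * ℓ + 1)) i with h | h <;> rw [h] at key
      · simpa [or_comm] using key
      · simpa using key
    · have e : i + 1 = ℓ := by omega
      have := offset_eq_or_neg ℓ i
      rw [e] at this
      rcases this with h | h <;> simp [h]
  inj i hi j hj := by split_ifs <;> omega
  pos i hi := by split_ifs <;> omega
  add_ne i hi j hj := by split_ifs <;> omega

lemma offset_zero {ℓ : ℕ} (hℓ : 2 ≤ ℓ) : offset ℓ 0 = 1 := by
  have : 0 < ℓ / 2 := by omega
  simp [offset, this]

lemma succ_div_mod_of_lt {ℓ t : ℕ} (h : t % ℓ + 1 < ℓ) :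
    (t + 1) / ℓ = t / ℓ ∧ (t + 1) % ℓ = t % ℓ + 1 := by
  have hℓ : 0 < ℓ := by omega
  rw [Nat.div_mod_unique hℓ]
  have := Nat.mod_add_div t ℓ
  omega

lemma succ_div_mod_of_eq {ℓ t : ℕ} (hℓ : 0 < ℓ) (h : t % ℓ + 1 = ℓ) :
    (t + 1) / ℓ = t / ℓ + 1 ∧ (t + 1) % ℓ = 0 := by
  rw [Nat.div_mod_unique hℓ]
  have := Nat.mod_add_div t ℓ
  have := Nat.mul_succ ℓ (t / ℓ)
  exact ⟨by rw [Nat.succ_eq_add_one] at this; omega, hℓ⟩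

lemma symmDiff_pair {α : Type*} [DecidableEq α] {p q r : α} (hpq : p ≠ q) (hpr : p ≠ r)
    (hqr : q ≠ r) : symmDiff ({p, q} : Finset α) {p, r} = {q, r} := by
  ext a
  simp only [Finset.mem_symmDiff, Finset.mem_insert, Finset.mem_singleton]
  grind

lemma sweep_eq (ℓ e t : ℕ) :
    sweep ℓ e t = {((-1) ^ e * ℓ : ZMod (2 * ℓ + 1)) * (t / ℓ : ℕ) +
        (0 : ℕ → ZMod (2 * ℓ + 1)) (t % ℓ),
      (-1) ^ e * ℓ * (t / ℓ : ℕ) + (0 : ℕ → ZMod (2 * ℓ + 1)) (t % ℓ) +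
        (fun i => (-1) ^ e * offset ℓ i) (t % ℓ)} := by
  simp [sweep]

lemma symmDiff_sweep {ℓ : ℕ} (hℓ : 2 ≤ ℓ) (e t : ℕ) :
    symmDiff (sweep ℓ e t) (sweep ℓ e (t + 1)) =
      {((-1) ^ e * ℓ : ZMod (2 * ℓ + 1)) * (t / ℓ : ℕ) +
          labelStart ℓ e (t % ℓ),
        (-1) ^ e * ℓ * (t / ℓ : ℕ) +
          labelStart ℓ e (t % ℓ) +
          (fun i => (-1) ^ e * labelOffset ℓ i) (t % ℓ)} := by
  have hr : t % ℓ < ℓ := Nat.mod_lt _ (by omega)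
  have hb := (isHalfSystem_offset ℓ).neg_pow_mul e
  have hd := (isHalfSystem_labelOffset hℓ).neg_pow_mul e
  have hL := two_mul_cast_add_one ℓ
  have hd0 := hd.ne_zero hr
  have hb0 := hb.ne_zero hr
  have hb2 := hb.ne_neg hr
  dsimp only
  by_cases h : t % ℓ + 1 < ℓ
  · obtain ⟨h1, h2⟩ := succ_div_mod_of_lt h
    have hb0' := hb.ne_zero h
    rw [labelOffset, if_pos h] at hd0
    rw [sweep, sweep, h1, h2, symmDiff_pair, labelStart, if_pos h, labelOffset, if_pos h]
    · congr 2; ring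
    · simpa using hb0
    · simpa using hb0'
    · intro h3
      exact hd0 (by linear_combination -h3)
  · have hlast : t % ℓ + 1 = ℓ := by omega
    obtain ⟨h1, h2⟩ := succ_div_mod_of_eq (by omega) hlast
    have hoff := offset_eq_or_neg ℓ (t % ℓ)
    rw [hlast] at hoff
    have hnext : sweep ℓ e (t + 1) =
        {((-1) ^ e * ℓ : ZMod (2 * ℓ + 1)) * (t / ℓ : ℕ) + (-1) ^ e * offset ℓ (t % ℓ),
          (-1) ^ e * ℓ * (t / ℓ : ℕ) + -((-1) ^ e * offset ℓ (t % ℓ))} := by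
      rw [sweep, h1, h2, offset_zero hℓ]
      rcases hoff with ho | ho
      · rw [ho]
        congr 1
        · push_cast; ring
        · congr 1; push_cast; linear_combination (-1) ^ e * hL
      · rw [ho, Finset.pair_comm]
        congr 1
        · push_cast; linear_combination (-1) ^ e * hL
        · congr 1; push_cast; ring
    rw [hnext, sweep, Finset.pair_comm, symmDiff_pair, labelStart, if_neg h, labelOffset, if_neg h]
    · simp
    · simpa using hb0
    · simpa using hb2
    · simpa using hb0

lemma sweep_periodic {ℓ : ℕ} (hℓ : 2 ≤ ℓ) (e t : ℕ) :
    sweep ℓ e (t + (2 * ℓ + 1).choose 2) = sweep ℓ e t := by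
  rw [choose_two_of_odd, sweep, sweep, Nat.add_mul_div_left _ _ (by omega), Nat.add_mul_mod_self_left,
    Nat.cast_add, ZMod.natCast_self, add_zero]

lemma isRainbowCycleC_sweep {ℓ : ℕ} (hℓ : 2 ≤ ℓ) (e : ℕ) :
    IsRainbowCycleC (2 * ℓ + 1) 2 ((2 * ℓ + 1).choose 2) (sweep ℓ e) := by
  have hb := (isHalfSystem_offset ℓ).neg_pow_mul e
  have hd := (isHalfSystem_labelOffset hℓ).neg_pow_mul e
  have h0 : 0 < ℓ := by omega
  have hs := isUnit_step ℓ e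
  refine ⟨Nat.choose_pos (by omega), sweep_periodic hℓ e,
    hb.injOn (c := 0) h0 hs (sweep_eq ℓ e),
    hb.card_eq_two (c := 0) h0 (sweep_eq ℓ e),
    hd.card_eq_two (c := labelStart ℓ e) h0 (symmDiff_sweep hℓ e), fun x y hxy => ?_⟩
  obtain ⟨t, ht, hxyt⟩ :=
    hd.surj (c := labelStart ℓ e) h0 hs (symmDiff_sweep hℓ e) {x, y} (Finset.card_pair hxy)
  refine Finset.card_eq_one.2 ⟨t, ?_⟩
  ext u
  rw [Finset.mem_filter, Finset.mem_range, Finset.mem_singleton]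
  constructor
  · rintro ⟨hu, hxyu⟩
    exact hd.injOn (c := labelStart ℓ e) h0 hs (symmDiff_sweep hℓ e) u hu t ht
      (hxyu.trans hxyt.symm)
  · rintro rfl
    exact ⟨ht, hxyt⟩

lemma sweep_surj {ℓ : ℕ} (hℓ : 2 ≤ ℓ) (e : ℕ) (A : Finset (ZMod (2 * ℓ + 1)))
    (hA : A.card = 2) : ∃ t < (2 * ℓ + 1).choose 2, sweep ℓ e t = A := by
  have hb := (isHalfSystem_offset ℓ).neg_pow_mul e
  have h0 : 0 < ℓ := by omega
  exact hb.surj (c := 0) h0 (isUnit_step ℓ e) (sweep_eq ℓ e) A hA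

/-- A pair of the cycle and a pair of its reflection agree only if they sit at the same
place in their blocks and the reflection exchanges their endpoints. -/
lemma sweep_zero_eq_sweep_one {ℓ : ℕ} (hℓ : 2 ≤ ℓ) {i j : ℕ} (h : sweep ℓ 0 i = sweep ℓ 1 j) :
    i % ℓ = j % ℓ ∧
      (ℓ * (i / ℓ : ℕ) + ℓ * (j / ℓ : ℕ) + offset ℓ (i % ℓ) : ZMod (2 * ℓ + 1)) = 0 := by
  have h' : ({(ℓ : ZMod (2 * ℓ + 1)) * (i / ℓ : ℕ),
      (ℓ : ZMod (2 * ℓ + 1)) * (i / ℓ : ℕ) + offset ℓ (i % ℓ)} : Finset _) =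
      {-(ℓ * (j / ℓ : ℕ)) - offset ℓ (j % ℓ),
        -(ℓ * (j / ℓ : ℕ)) - offset ℓ (j % ℓ) + offset ℓ (j % ℓ)} := by
    rw [sweep, sweep, Finset.pair_comm ((-1) ^ 1 * _ * _)] at h
    convert h using 2
    · ring
    · congr 1; ring
    · ring
    · congr 1; ring
  obtain ⟨h1, h2⟩ := (isHalfSystem_offset ℓ).pair_inj (Nat.mod_lt _ (by omega))
    (Nat.mod_lt _ (by omega)) h'
  exact ⟨h1, by rw [h1]; linear_combination h2⟩

lemma sweep_edge_disjoint_parallel {ℓ : ℕ} (hℓ : 2 ≤ ℓ) {i j : ℕ}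
    (h : sweep ℓ 0 i = sweep ℓ 1 j) (h' : sweep ℓ 0 (i + 1) = sweep ℓ 1 (j + 1)) : False := by
  obtain ⟨h1, h2⟩ := sweep_zero_eq_sweep_one hℓ h
  obtain ⟨-, h3⟩ := sweep_zero_eq_sweep_one hℓ h'
  have hr : i % ℓ < ℓ := Nat.mod_lt _ (by omega)
  have hb := isHalfSystem_offset ℓ
  by_cases hlt : i % ℓ + 1 < ℓ
  · obtain ⟨hi, hi'⟩ := succ_div_mod_of_lt hlt
    obtain ⟨hj, -⟩ := succ_div_mod_of_lt (h1 ▸ hlt)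
    rw [hi, hi', hj] at h3
    have := hb.eq_of_eq_or_eq_neg hr hlt (Or.inl (by linear_combination h2 - h3))
    omega
  · have hlast : i % ℓ + 1 = ℓ := by omega
    obtain ⟨hi, hi'⟩ := succ_div_mod_of_eq (by omega) hlast
    obtain ⟨hj, -⟩ := succ_div_mod_of_eq (by omega) (h1 ▸ hlast)
    rw [hi, hi', hj, offset_zero hℓ] at h3
    push_cast at h3
    exact hb.ne_zero hr (by linear_combination h2 - h3 + two_mul_cast_add_one ℓ)

lemma sweep_edge_disjoint_antiparallel {ℓ : ℕ} (hℓ : 2 ≤ ℓ) {i j : ℕ}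
    (h : sweep ℓ 0 i = sweep ℓ 1 (j + 1)) (h' : sweep ℓ 0 (i + 1) = sweep ℓ 1 j) : False := by
  obtain ⟨h1, h2⟩ := sweep_zero_eq_sweep_one hℓ h
  obtain ⟨h1', h3⟩ := sweep_zero_eq_sweep_one hℓ h'
  obtain rfl : ℓ = 2 := by
    have e : i + 2 ≡ i [MOD ℓ] := (show i + 1 ≡ j [MOD ℓ] from h1').add_right 1 |>.trans
      (show i ≡ j + 1 [MOD ℓ] from h1).symm
    have : ℓ ∣ 2 := by
      have := (Nat.modEq_iff_dvd' (by omega)).1 e.symm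
      simpa using this
    exact le_antisymm (Nat.le_of_dvd (by norm_num) this) hℓ
  have hne : (1 : ZMod (2 * 2 + 1)) ≠ 0 := by decide
  rcases Nat.mod_two_eq_zero_or_one i with hi | hi
  · have hj : j % 2 = 1 := by omega
    rw [show (j + 1) / 2 = j / 2 + 1 by omega, hi] at h2
    rw [show (i + 1) / 2 = i / 2 by omega, show (i + 1) % 2 = 1 by omega] at h3
    simp [offset] at h2 h3
    exact hne (by linear_combination h2 - h3)
  · have hj : j % 2 = 0 := by omega
    rw [show (j + 1) / 2 = j / 2 by omega, hi] at h2
    rw [show (i + 1) / 2 = i / 2 + 1 by omega, show (i + 1) % 2 = 0 by omega] at h3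
    simp [offset] at h2 h3
    exact hne (by linear_combination h3 - h2)

end RainbowSubsets

/-- For every odd `n ≥ 5`, the flip graph of 2-element subsets of `{1, …, n}`
contains two rainbow Hamilton cycles that are edge-disjoint: no edge of the
flip graph is used by both cycles. -/
theorem subsets_two_edge_disjoint_rainbow_hamilton_cycles (n : ℕ)
    (hn : 5 ≤ n) (hodd : Odd n) :
    ∃ V W : ℕ → Finset (Fin n),
      (IsRainbowCycleC n 2 (n.choose 2) V ∧
        ∀ A : Finset (Fin n), A.card = 2 → ∃ i < n.choose 2, V i = A) ∧
      (IsRainbowCycleC n 2 (n.choose 2) W ∧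
        ∀ A : Finset (Fin n), A.card = 2 → ∃ i < n.choose 2, W i = A) ∧
      (∀ i < n.choose 2, ∀ j < n.choose 2,
        ¬ ((V i = W j ∧ V (i + 1) = W (j + 1)) ∨
           (V i = W (j + 1) ∧ V (i + 1) = W j))) := by
  obtain ⟨ℓ, rfl⟩ := hodd
  have hℓ : 2 ≤ ℓ := by omega
  refine ⟨RainbowSubsets.sweep ℓ 0, RainbowSubsets.sweep ℓ 1,
    ⟨RainbowSubsets.isRainbowCycleC_sweep hℓ 0, RainbowSubsets.sweep_surj hℓ 0⟩,
    ⟨RainbowSubsets.isRainbowCycleC_sweep hℓ 1, RainbowSubsets.sweep_surj hℓ 1⟩, ?_⟩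
  rintro i - j - (⟨h, h'⟩ | ⟨h, h'⟩)
  · exact RainbowSubsets.sweep_edge_disjoint_parallel hℓ h h'
  · exact RainbowSubsets.sweep_edge_disjoint_antiparallel hℓ h h'
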